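/- arXiv:1103.0603 — 3 statements merged into one kernel-verified Lean document; each statement's English description precedes it below -/
import Mathlib

section
/- Suppose αβ > 0 and Δ = 0. Then there exist an integer N ≥ 1 and positive constants γ_1,…,γ_N such that for (x,y) ∈ ℝ²_{>0} one has Λ^A_{α,β}(x,y) = 0 if and only if y = γ_i x for some i ∈ {1,…,N}. -/
open scoped BigOperators
noncomputable section
namespace LamSec

variable {ι : Type*} [Fintype ι]

/-- `D` is the least common denominator of the (nonzero) `p i` and `q i`:
`D > 0`, `D` clears all denominators, and `D` divides any other positive
integer clearing all denominators. -/
def IsLCD (p q : ι → ℚ) (D : ℕ) : Prop :=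
  0 < D ∧ (∀ i, (p i * (D : ℚ)).den = 1 ∧ (q i * (D : ℚ)).den = 1) ∧
    ∀ D' : ℕ, 0 < D' →
      (∀ i, (p i * (D' : ℚ)).den = 1 ∧ (q i * (D' : ℚ)).den = 1) → D ∣ D'

/-- The function `Λ^A_{α,β}(x,y)`, where `e i` is the integer `p i * α - q i * β`. -/
def Lam (p q : ι → ℚ) (e : ι → ℤ) (A : ℝ) (D : ℕ) (α β : ℤ) (x y : ℝ) : ℝ :=
  x ^ α * y ^ (-β) * ∏ i, ((p i : ℝ) * x + (q i : ℝ) * y) ^ (e i) - A ^ D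

/-- `Δ = (1 + Σ p_i) α − (1 + Σ q_i) β`. -/
def Del (p q : ι → ℚ) (α β : ℤ) : ℚ :=
  (1 + ∑ i, p i) * (α : ℚ) - (1 + ∑ i, q i) * (β : ℚ)

open Filter Topology in
theorem aux_lim (ι : Type) [Fintype ι] (p q : ι → ℝ)
    (e : ι → ℤ) (a : ℤ) :
    ∃ g : ℝ → ℝ, (∀ t, 0 < t → t ^ a * ∏ i, (p i + q i * t) ^ (e i)
        = t ^ (a + ∑ i, if p i = 0 then e i else 0) * g t) ∧
      ((∀ i, 0 ≤ p i ∧ 0 ≤ q i ∧ ¬(p i = 0 ∧ q i = 0)) →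
        ∃ c, 0 < c ∧ Tendsto g (𝓝[>] 0) (𝓝 c)) := by
  refine ⟨fun t => ∏ i, if p i = 0 then (q i) ^ (e i) else (p i + q i * t) ^ (e i), ?_, ?_⟩
  · intro t ht
    have hz : ∀ s : Finset ι, t ^ (∑ i ∈ s, if p i = 0 then e i else 0)
        = ∏ i ∈ s, t ^ (if p i = 0 then e i else 0) := by
      intro s
      classical
      induction s using Finset.induction_on with
      | empty => simp
      | insert i s hi ih => rw [Finset.sum_insert hi, Finset.prod_insert hi, zpow_add₀ ht.ne', ih]
    rw [zpow_add₀ ht.ne', hz, mul_assoc, ← Finset.prod_mul_distrib]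
    congr 1
    apply Finset.prod_congr rfl
    intro i _
    by_cases h : p i = 0
    · simp [h, mul_zpow, mul_comm]
    · simp [h]
  · intro hpq
    refine ⟨∏ i, if p i = 0 then (q i) ^ (e i) else (p i) ^ (e i), ?_, ?_⟩
    · apply Finset.prod_pos
      intro i _
      obtain ⟨h1, h2, h3⟩ := hpq i
      split_ifs with h
      · exact zpow_pos (lt_of_le_of_ne h2 (fun h' => h3 ⟨h, h'.symm⟩)) _
      · exact zpow_pos (lt_of_le_of_ne h1 (Ne.symm h)) _
    · apply tendsto_finsetProd
      intro i _
      split_ifs with h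
      · exact tendsto_const_nhds
      · have : ContinuousAt (fun t : ℝ => (p i + q i * t) ^ (e i)) 0 := by
          apply ContinuousAt.zpow₀
          · fun_prop
          · left; simpa using h
        have h2 := this.tendsto.mono_left (nhdsWithin_le_nhds (s := Set.Ioi 0))
        simpa using h2

open Filter Topology in
theorem aux_top (ι : Type) [Fintype ι] (p q : ι → ℝ)
    (hpq : ∀ i, 0 ≤ p i ∧ 0 ≤ q i ∧ ¬(p i = 0 ∧ q i = 0))
    (e : ι → ℤ) (a : ℤ) (hk : a + (∑ i, if p i = 0 then e i else 0) < 0) :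
    Tendsto (fun t : ℝ => t ^ a * ∏ i, (p i + q i * t) ^ (e i)) (𝓝[>] 0) atTop := by
  obtain ⟨g, hg, h⟩ := aux_lim ι p q e a
  obtain ⟨c, hc, h⟩ := h hpq
  set k := a + (∑ i, if p i = 0 then e i else 0) with hkdef
  have h1 : Tendsto (fun t : ℝ => t ^ k) (𝓝[>] 0) atTop := by
    obtain ⟨n, hn⟩ : ∃ n : ℕ, k = -(n : ℤ) := ⟨(-k).toNat, by omega⟩
    have h0 : n ≠ 0 := by omega
    rw [hn]
    have := (tendsto_pow_atTop (α := ℝ) h0).comp (tendsto_inv_nhdsGT_zero (𝕜 := ℝ))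
    refine this.congr ?_
    intro t; simp
  refine (h1.atTop_mul_pos hc h).congr' ?_
  filter_upwards [self_mem_nhdsWithin] with t ht
  exact (hg t ht).symm

open Filter Topology in
theorem aux_zero (ι : Type) [Fintype ι] (p q : ι → ℝ)
    (hpq : ∀ i, 0 ≤ p i ∧ 0 ≤ q i ∧ ¬(p i = 0 ∧ q i = 0))
    (e : ι → ℤ) (a : ℤ) (hk : 0 < a + (∑ i, if p i = 0 then e i else 0)) :
    Tendsto (fun t : ℝ => t ^ a * ∏ i, (p i + q i * t) ^ (e i)) (𝓝[>] 0) (𝓝 0) := by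
  obtain ⟨g, hg, h⟩ := aux_lim ι p q e a
  obtain ⟨c, hc, h⟩ := h hpq
  set k := a + (∑ i, if p i = 0 then e i else 0) with hkdef
  have h1 : Tendsto (fun t : ℝ => t ^ k) (𝓝[>] 0) (𝓝 0) := by
    obtain ⟨n, hn⟩ : ∃ n : ℕ, k = (n : ℤ) := ⟨k.toNat, by omega⟩
    have h0 : n ≠ 0 := by omega
    rw [hn]
    have := ((continuous_pow (M := ℝ) n).tendsto 0).mono_left
      (nhdsWithin_le_nhds (s := Set.Ioi 0))
    simpa [h0] using this
  have h2 := h1.mul h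
  rw [zero_mul] at h2
  refine h2.congr' ?_
  filter_upwards [self_mem_nhdsWithin] with t ht
  exact (hg t ht).symm

def RatPos (f : ℝ → ℝ) : Prop :=
  ∃ P Q : Polynomial ℝ, ∀ t, 0 < t → Q.eval t ≠ 0 ∧ f t * Q.eval t = P.eval t

theorem RatPos.mul {f g : ℝ → ℝ} (hf : RatPos f) (hg : RatPos g) :
    RatPos (fun t => f t * g t) := by
  obtain ⟨P, Q, h⟩ := hf
  obtain ⟨P', Q', h'⟩ := hg
  refine ⟨P * P', Q * Q', fun t ht => ?_⟩
  obtain ⟨h1, h2⟩ := h t ht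
  obtain ⟨h3, h4⟩ := h' t ht
  simp only [Polynomial.eval_mul]
  refine ⟨mul_ne_zero h1 h3, ?_⟩
  rw [← h2, ← h4]; ring

theorem RatPos.lin (p q : ℝ) (h : ∀ t, 0 < t → p + q * t ≠ 0) (e : ℤ) :
    RatPos (fun t => (p + q * t) ^ e) := by
  obtain ⟨n, rfl | rfl⟩ := e.eq_nat_or_neg
  · refine ⟨(Polynomial.C p + Polynomial.C q * Polynomial.X) ^ n, 1, fun t ht => ?_⟩
    simp
  · refine ⟨1, (Polynomial.C p + Polynomial.C q * Polynomial.X) ^ n, fun t ht => ?_⟩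
    have := pow_ne_zero n (h t ht)
    simp only [Polynomial.eval_pow, Polynomial.eval_add, Polynomial.eval_mul, Polynomial.eval_C,
      Polynomial.eval_X, Polynomial.eval_one, zpow_neg, zpow_natCast]
    exact ⟨this, inv_mul_cancel₀ this⟩

theorem RatPos.prod {ι : Type} (s : Finset ι) (f : ι → ℝ → ℝ) (h : ∀ i, RatPos (f i)) :
    RatPos (fun t => ∏ i ∈ s, f i t) := by
  classical
  induction s using Finset.induction_on with
  | empty => exact ⟨1, 1, by simp⟩
  | insert i s hi ih =>
    simp only [Finset.prod_insert hi]
    exact (h i).mul ih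

theorem RatPos.finite {f : ℝ → ℝ} (hf : RatPos f) (c : ℝ) (hne : ∃ t, 0 < t ∧ f t ≠ c) :
    {t : ℝ | 0 < t ∧ f t = c}.Finite := by
  obtain ⟨P, Q, h⟩ := hf
  have h0 : P - Polynomial.C c * Q ≠ 0 := by
    intro h0
    obtain ⟨t, ht, hft⟩ := hne
    obtain ⟨h1, h2⟩ := h t ht
    have := congrArg (Polynomial.eval t) h0
    simp only [Polynomial.eval_sub, Polynomial.eval_mul, Polynomial.eval_C,
      Polynomial.eval_zero, ← h2] at this
    apply hft
    have h3 : (f t - c) * Q.eval t = 0 := by linarith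
    rcases mul_eq_zero.1 h3 with h4 | h4
    · linarith
    · exact absurd h4 h1
  refine (Polynomial.finite_setOfPred_isRoot h0).subset ?_
  rintro t ⟨ht, hft⟩
  obtain ⟨h1, h2⟩ := h t ht
  simp [Polynomial.IsRoot, ← h2, hft]

open Filter Topology in
theorem aux_ex {f h : ℝ → ℝ} (hf : Tendsto f (𝓝[>] 0) atTop) (hh : Tendsto h (𝓝[>] 0) (𝓝 0))
    (C : ℝ) (hC : 0 < C) : (∃ t, 0 < t ∧ C < f t) ∧ (∃ t, 0 < t ∧ h t < C) := by
  constructor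
  · obtain ⟨t, h1, h2⟩ := ((hf.eventually_gt_atTop C).and self_mem_nhdsWithin).exists
    exact ⟨t, h2, h1⟩
  · obtain ⟨t, h1, h2⟩ := ((hh.eventually_lt_const hC).and self_mem_nhdsWithin).exists
    exact ⟨t, h2, h1⟩

/-- If `αβ > 0` and `Δ = 0`, the zero set of `Λ^A_{α,β}` in the
open positive quadrant is a finite nonempty union of lines through the origin
`y = γ_i x` with `γ_i > 0`. -/
theorem lam_zero_set_union_of_lines
    (ι : Type) [Fintype ι] (p q : ι → ℚ)
    (hpq : ∀ i, 0 ≤ p i ∧ 0 ≤ q i ∧ ¬(p i = 0 ∧ q i = 0))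
    (D : ℕ) (hD : IsLCD p q D)
    (A : ℝ) (hA : 0 < A)
    (α β : ℤ) (hα : α ≠ 0) (hβ : β ≠ 0)
    (e : ι → ℤ) (he : ∀ i, (e i : ℚ) = p i * (α : ℚ) - q i * (β : ℚ))
    (hαβ : 0 < α * β) (hΔ : Del p q α β = 0) :
    ∃ (N : ℕ) (γ : Fin N → ℝ), 1 ≤ N ∧ (∀ i, 0 < γ i) ∧
      ∀ x y : ℝ, 0 < x → 0 < y →
        (Lam p q e A D α β x y = 0 ↔ ∃ i : Fin N, y = γ i * x) := by
  have hpq' : ∀ i, 0 ≤ (p i : ℝ) ∧ 0 ≤ (q i : ℝ) ∧ ¬((p i : ℝ) = 0 ∧ (q i : ℝ) = 0) := by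
    intro i
    exact_mod_cast hpq i
  have hqp' : ∀ i, 0 ≤ (q i : ℝ) ∧ 0 ≤ (p i : ℝ) ∧ ¬((q i : ℝ) = 0 ∧ (p i : ℝ) = 0) := by
    intro i
    obtain ⟨h1, h2, h3⟩ := hpq' i
    exact ⟨h2, h1, fun h => h3 h.symm⟩
  have hlin : ∀ i (x y : ℝ), 0 < x → 0 < y → 0 < (p i : ℝ) * x + (q i : ℝ) * y := by
    intro i x y hx hy
    obtain ⟨h1, h2, h3⟩ := hpq' i
    rcases h1.lt_or_eq with h | h
    · have := mul_pos h hx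
      have := mul_nonneg h2 hy.le
      linarith
    · have h4 : 0 < (q i : ℝ) := lt_of_le_of_ne h2 (fun h' => h3 ⟨h.symm, h'.symm⟩)
      have := mul_pos h4 hy
      have := mul_nonneg h1 hx.le
      linarith
  set G : ℝ → ℝ → ℝ := fun x y =>
    x ^ α * y ^ (-β) * ∏ i, ((p i : ℝ) * x + (q i : ℝ) * y) ^ (e i) with hG
  have hLam : ∀ x y, Lam p q e A D α β x y = 0 ↔ G x y = A ^ D := by
    intro x y
    simp only [Lam, hG, sub_eq_zero]
  set C : ℝ := A ^ D with hCdef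
  have hC : 0 < C := pow_pos hA D
  have hdeg : α + -β + ∑ i, e i = 0 := by
    have : ((α + -β + ∑ i, e i : ℤ) : ℚ) = 0 := by
      push_cast
      simp only [he, Finset.sum_sub_distrib, ← Finset.sum_mul]
      unfold Del at hΔ
      linarith
    exact_mod_cast this
  have hhom : ∀ c x y : ℝ, 0 < c → G (c * x) (c * y) = G x y := by
    intro c x y hc
    have hz : ∀ s : Finset ι, c ^ (∑ i ∈ s, e i) = ∏ i ∈ s, c ^ (e i) := by
      intro s
      classical
      induction s using Finset.induction_on with
      | empty => simp
      | insert i s hi ih => rw [Finset.sum_insert hi, Finset.prod_insert hi, zpow_add₀ hc.ne', ih]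
    have h1 : ∏ i, ((p i : ℝ) * (c * x) + (q i : ℝ) * (c * y)) ^ (e i)
        = c ^ (∑ i, e i) * ∏ i, ((p i : ℝ) * x + (q i : ℝ) * y) ^ (e i) := by
      rw [hz, ← Finset.prod_mul_distrib]
      apply Finset.prod_congr rfl
      intro i _
      rw [← mul_zpow]; congr 1; ring
    have h2 : c ^ α * c ^ (-β) * c ^ (∑ i, e i) = 1 := by
      rw [← zpow_add₀ hc.ne', ← zpow_add₀ hc.ne', hdeg, zpow_zero]
    simp only [hG]
    rw [h1, mul_zpow, mul_zpow]
    calc _ = (c ^ α * c ^ (-β) * c ^ (∑ i, e i)) *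
          (x ^ α * y ^ (-β) * ∏ i, ((p i : ℝ) * x + (q i : ℝ) * y) ^ (e i)) := by ring
      _ = _ := by rw [h2, one_mul]
  have hf1 : (fun t => G 1 t) = fun t : ℝ => t ^ (-β) * ∏ i, ((p i : ℝ) + (q i : ℝ) * t) ^ (e i) := by
    funext t; simp [hG]
  have hf2 : (fun t => G t 1) = fun t : ℝ => t ^ α * ∏ i, ((q i : ℝ) + (p i : ℝ) * t) ^ (e i) := by
    funext t; simp [hG, add_comm]
  have hswap : ∀ t, 0 < t → G t 1 = G 1 t⁻¹ := by
    intro t ht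
    have := hhom t 1 t⁻¹ ht
    rwa [mul_one, mul_inv_cancel₀ ht.ne'] at this
  -- signs of the exponents
  have hk1 : ((-β + ∑ i, (if (p i : ℝ) = 0 then e i else 0) : ℤ) : ℚ)
      = -(β * (1 + ∑ i, if p i = 0 then q i else 0)) := by
    push_cast
    have : ∀ i, ((if (p i : ℝ) = 0 then (e i : ℚ) else 0)) = -(β * if p i = 0 then q i else 0) := by
      intro i
      by_cases h : p i = 0
      · simp [h, he i, mul_comm]
      · simp [h]
    simp only [this, Finset.sum_neg_distrib, ← Finset.mul_sum]
    ring
  have hk2 : ((α + ∑ i, (if (q i : ℝ) = 0 then e i else 0) : ℤ) : ℚ)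
      = α * (1 + ∑ i, if q i = 0 then p i else 0) := by
    push_cast
    have : ∀ i, ((if (q i : ℝ) = 0 then (e i : ℚ) else 0)) = (α * if q i = 0 then p i else 0) := by
      intro i
      by_cases h : q i = 0
      · simp [h, he i, mul_comm]
      · simp [h]
    simp only [this, ← Finset.mul_sum]
    ring
  have hs1 : 0 < 1 + ∑ i, if p i = 0 then q i else 0 := by
    have : 0 ≤ ∑ i, if p i = 0 then q i else 0 := by
      apply Finset.sum_nonneg
      intro i _
      split_ifs
      · exact (hpq i).2.1
      · exact le_rfl
    linarith
  have hs2 : 0 < 1 + ∑ i, if q i = 0 then p i else 0 := by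
    have : 0 ≤ ∑ i, if q i = 0 then p i else 0 := by
      apply Finset.sum_nonneg
      intro i _
      split_ifs
      · exact (hpq i).1
      · exact le_rfl
    linarith
  have hex : (∃ t, 0 < t ∧ C < G 1 t) ∧ (∃ t, 0 < t ∧ G 1 t < C) := by
    rcases pos_and_pos_or_neg_and_neg_of_mul_pos hαβ with ⟨ha, hb⟩ | ⟨ha, hb⟩
    · have ha' : (0 : ℚ) < α := by exact_mod_cast ha
      have hb' : (0 : ℚ) < β := by exact_mod_cast hb
      have t1 := aux_top ι (fun i => (p i : ℝ)) (fun i => (q i : ℝ)) hpq' e (-β) (by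
        have := mul_pos hb' hs1
        have h : ((-β + ∑ i, (if (p i : ℝ) = 0 then e i else 0) : ℤ) : ℚ) < 0 := by
          rw [hk1]; linarith
        exact_mod_cast h)
      have t2 := aux_zero ι (fun i => (q i : ℝ)) (fun i => (p i : ℝ)) hqp' e α (by
        have h : 0 < ((α + ∑ i, (if (q i : ℝ) = 0 then e i else 0) : ℤ) : ℚ) := by
          rw [hk2]; exact mul_pos ha' hs2
        exact_mod_cast h)
      rw [← hf1] at t1
      rw [← hf2] at t2
      obtain ⟨h1, t, ht, h2⟩ := aux_ex t1 t2 C hC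
      exact ⟨h1, t⁻¹, inv_pos.2 ht, hswap t ht ▸ h2⟩
    · have ha' : (α : ℚ) < 0 := by exact_mod_cast ha
      have hb' : (β : ℚ) < 0 := by exact_mod_cast hb
      have t1 := aux_zero ι (fun i => (p i : ℝ)) (fun i => (q i : ℝ)) hpq' e (-β) (by
        have := mul_neg_of_neg_of_pos hb' hs1
        have h : 0 < ((-β + ∑ i, (if (p i : ℝ) = 0 then e i else 0) : ℤ) : ℚ) := by
          rw [hk1]; linarith
        exact_mod_cast h)
      have t2 := aux_top ι (fun i => (q i : ℝ)) (fun i => (p i : ℝ)) hqp' e α (by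
        have h : ((α + ∑ i, (if (q i : ℝ) = 0 then e i else 0) : ℤ) : ℚ) < 0 := by
          rw [hk2]; exact mul_neg_of_neg_of_pos ha' hs2
        exact_mod_cast h)
      rw [← hf1] at t1
      rw [← hf2] at t2
      obtain ⟨⟨t, ht, h2⟩, h1⟩ := aux_ex t2 t1 C hC
      exact ⟨⟨t⁻¹, inv_pos.2 ht, hswap t ht ▸ h2⟩, h1⟩
  obtain ⟨⟨a, ha, hGa⟩, ⟨b, hb, hGb⟩⟩ := hex
  have hcont : ContinuousOn (fun t => G 1 t) (Set.Ioi 0) := by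
    rw [hf1]
    apply ContinuousOn.mul
    · exact continuousOn_id.zpow₀ _ (fun t ht => Or.inl (ne_of_gt ht))
    · apply continuousOn_finsetProd
      intro i _
      apply ContinuousOn.zpow₀
      · fun_prop
      · intro t ht
        left
        have := hlin i 1 t one_pos ht
        rw [mul_one] at this
        exact this.ne'
  obtain ⟨t₀, ht₀, hGt₀⟩ : C ∈ (fun t => G 1 t) '' Set.Ioi 0 :=
    isPreconnected_Ioi.intermediate_value hb ha hcont ⟨hGb.le, hGa.le⟩
  have hfin : {t : ℝ | 0 < t ∧ G 1 t = C}.Finite := by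
    apply RatPos.finite (f := fun t => G 1 t) _ C ⟨a, ha, hGa.ne'⟩
    rw [hf1]
    apply RatPos.mul
    · have := RatPos.lin 0 1 (fun t ht => by simpa using ht.ne') (-β)
      simpa using this
    · apply RatPos.prod Finset.univ (fun i t => ((p i : ℝ) + (q i : ℝ) * t) ^ (e i))
      intro i
      apply RatPos.lin
      intro t ht
      have := hlin i 1 t one_pos ht
      rw [mul_one] at this
      exact this.ne'
  have hmem : ∀ t, t ∈ hfin.toFinset ↔ 0 < t ∧ G 1 t = C := by
    intro t; simp
  refine ⟨hfin.toFinset.card, fun i => (hfin.toFinset.equivFin.symm i : ℝ), ?_, ?_, ?_⟩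
  · exact Finset.card_pos.2 ⟨t₀, (hmem t₀).2 ⟨ht₀, hGt₀⟩⟩
  · intro i
    exact ((hmem _).1 (hfin.toFinset.equivFin.symm i).2).1
  · intro x y hx hy
    rw [hLam]
    have hxy : G x y = G 1 (y / x) := by
      have := hhom x 1 (y / x) hx
      rwa [mul_one, mul_div_cancel₀ _ hx.ne'] at this
    rw [hxy]
    constructor
    · intro h
      refine ⟨hfin.toFinset.equivFin ⟨y / x, (hmem _).2 ⟨div_pos hy hx, h⟩⟩, ?_⟩
      beta_reduce
      rw [Equiv.symm_apply_apply]
      exact (div_mul_cancel₀ y hx.ne').symm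
    · rintro ⟨i, hi⟩
      have h := ((hmem _).1 (hfin.toFinset.equivFin.symm i).2).2
      rw [hi, mul_div_cancel_right₀ _ hx.ne']
      exact h

end LamSec
end
end

section
/- Let S ⊆ ℝⁿ be a linear subspace with S ∩ ℝⁿ_{>0} ≠ ∅, let c₀ ∈ ℝⁿ, let S(c₀) = (c₀+S) ∩ ℝⁿ_{≥0} be a polyhedron of dimension at most two, and let F_W be a face of S(c₀), where W ⊆ {1,…,n} is maximal with F_W ⊆ Z_W. Then there exists δ > 0 such that dist(x, F_W) ≤ δ · dist(x, Z_W) for all x ∈ S(c₀). -/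
open scoped BigOperators
noncomputable section
namespace CRN

abbrev Vec (n : ℕ) := EuclideanSpace ℝ (Fin n)

variable {n : ℕ}

/-- The stoichiometric compatibility class `S(c₀) = (c₀ + S) ∩ ℝⁿ_{≥0}`. -/
def SClass (S : Submodule ℝ (Vec n)) (c₀ : Vec n) : Set (Vec n) :=
  {x | (∀ i, 0 ≤ x i) ∧ x - c₀ ∈ S}

/-- `Z_W = {x ∈ ℝⁿ : x_i = 0 for all i ∈ W}`. -/
def ZSet (n : ℕ) (W : Finset (Fin n)) : Set (Vec n) :=
  {x : Vec n | ∀ i ∈ W, x i = 0}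

/-- The face `F_W = S(c₀) ∩ Z_W` of the stoichiometric compatibility class. -/
def FFace (S : Submodule ℝ (Vec n)) (c₀ : Vec n) (W : Finset (Fin n)) : Set (Vec n) :=
  SClass S c₀ ∩ ZSet n W

lemma step_aux (e z : Vec n) (hs : ∀ i, SignType.sign (e i) = SignType.sign (z i))
    (hz : ∃ i, z i ≠ 0) : ∃ α : ℝ, 0 ≤ α ∧ (∃ i, z i ≠ 0 ∧ z i - α * e i = 0) ∧
      (∀ i, 0 ≤ z i → 0 ≤ α * e i ∧ α * e i ≤ z i) ∧
      (∀ i, z i ≤ 0 → α * e i ≤ 0 ∧ z i ≤ α * e i) := by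
  have hpos : ∀ i, 0 < z i → 0 < e i := fun i h => by
    have := hs i
    rw [sign_pos h] at this
    exact sign_eq_one_iff.mp this
  have hneg : ∀ i, z i < 0 → e i < 0 := fun i h => by
    have := hs i
    rw [sign_neg h] at this
    exact sign_eq_neg_one_iff.mp this
  have hzero : ∀ i, z i = 0 → e i = 0 := fun i h => by
    have := hs i
    rw [h, sign_zero] at this
    exact sign_eq_zero_iff.mp this
  obtain ⟨j, hj⟩ := hz
  obtain ⟨i₀, hi₀, hmin⟩ := Finset.exists_min_image
    (Finset.univ.filter (fun i => z i ≠ 0)) (fun i => z i / e i) ⟨j, by simpa using hj⟩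
  simp only [Finset.mem_filter, Finset.mem_univ, true_and] at hi₀ hmin
  have hα : 0 ≤ z i₀ / e i₀ := by
    rcases lt_or_gt_of_ne hi₀ with h | h
    · exact (div_pos_of_neg_of_neg h (hneg _ h)).le
    · exact (div_pos h (hpos _ h)).le
  have he₀ : e i₀ ≠ 0 := by
    rcases lt_or_gt_of_ne hi₀ with h | h
    · exact (hneg _ h).ne
    · exact (hpos _ h).ne'
  refine ⟨z i₀ / e i₀, hα, ⟨i₀, hi₀, by field_simp; ring⟩, ?_, ?_⟩
  · intro i h
    rcases h.eq_or_lt with h | h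
    · simp [hzero i h.symm, ← h]
    · have h1 := hpos i h
      exact ⟨by positivity, (le_div_iff₀ h1).mp (hmin i h.ne')⟩
  · intro i h
    rcases h.eq_or_lt with h | h
    · simp [hzero i h, h]
    · have h1 := hneg i h
      exact ⟨mul_nonpos_of_nonneg_of_nonpos hα h1.le, (le_div_iff_of_neg h1).mp (hmin i h.ne)⟩

lemma hoffman_aux (S : Submodule ℝ (Vec n)) (W : Finset (Fin n)) :
    ∃ C : ℝ, 0 ≤ C ∧ ∀ k : ℕ, ∀ z ∈ S, (Finset.univ.filter (fun i => z i ≠ 0)).card ≤ k →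
      (∀ i ∈ W, 0 ≤ z i) → ∃ u ∈ S, (∀ i ∈ W, u i = 0) ∧
      (∀ i, 0 ≤ z i → 0 ≤ u i ∧ u i ≤ z i) ∧
      (∀ i, z i ≤ 0 → u i ≤ 0 ∧ z i ≤ u i) ∧ ‖z - u‖ ≤ C * ∑ i ∈ W, z i := by
  have hch : ∀ σ : Fin n → SignType, ∃ e : Vec n,
      (∃ z ∈ S, ∀ i, SignType.sign (z i) = σ i) → e ∈ S ∧ ∀ i, SignType.sign (e i) = σ i := by
    intro σ
    by_cases h : ∃ z ∈ S, ∀ i, SignType.sign (z i) = σ i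
    · obtain ⟨z, hz⟩ := h
      exact ⟨z, fun _ => hz⟩
    · exact ⟨0, fun h' => absurd h' h⟩
  choose e he using hch
  have hnn : ∀ σ, 0 ≤ ‖e σ‖ / |∑ i ∈ W, e σ i| := fun σ => by positivity
  refine ⟨∑ σ, ‖e σ‖ / |∑ i ∈ W, e σ i|, Finset.sum_nonneg fun σ _ => hnn σ, ?_⟩
  have hC : ∀ σ, ‖e σ‖ / |∑ i ∈ W, e σ i| ≤ ∑ σ, ‖e σ‖ / |∑ i ∈ W, e σ i| := fun σ =>
    Finset.single_le_sum (f := fun σ => ‖e σ‖ / |∑ i ∈ W, e σ i|) (fun σ _ => hnn σ)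
      (Finset.mem_univ σ)
  generalize (∑ σ, ‖e σ‖ / |∑ i ∈ W, e σ i|) = C at hC
  intro k
  induction k with
  | zero =>
    intro z hz hk hW
    have hz0 : ∀ i, z i = 0 := by
      simpa [Finset.filter_eq_empty_iff] using hk
    have : z = 0 := by ext i; simp [hz0 i]
    subst this
    exact ⟨0, S.zero_mem, by simp, by simp, by simp, by simp⟩
  | succ k ih =>
    intro z hz hk hW
    by_cases hne : ∃ i, z i ≠ 0
    swap
    · push Not at hne
      have : z = 0 := by ext i; simp [hne i]
      subst this
      exact ⟨0, S.zero_mem, by simp, by simp, by simp, by simp⟩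
    obtain ⟨heS, hes⟩ := he (fun i => SignType.sign (z i)) ⟨z, hz, fun _ => rfl⟩
    have hCe := hC (fun i => SignType.sign (z i))
    generalize e (fun i => SignType.sign (z i)) = v at heS hes hCe
    obtain ⟨α, hα, ⟨i₀, hi₀, hi₀'⟩, hp, hm⟩ := step_aux v z hes hne
    have hvW : ∀ i ∈ W, 0 ≤ v i := by
      intro i hi
      have := hes i
      rw [← sign_nonneg_iff, this, sign_nonneg_iff]
      exact hW i hi
    obtain ⟨u, huS, huW, hup, hum, hun⟩ := ih (z - α • v) (S.sub_mem hz (S.smul_mem _ heS))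
      (by
        have : (Finset.univ.filter (fun i => (z - α • v) i ≠ 0)) ⊂
            Finset.univ.filter (fun i => z i ≠ 0) := by
          rw [Finset.ssubset_iff_of_subset]
          · exact ⟨i₀, by simpa using hi₀, fun hc => (Finset.mem_filter.mp hc).2 (by simpa using hi₀')⟩
          · intro i
            simp only [Finset.mem_filter, Finset.mem_univ, true_and]
            intro h h0
            have h1 := hp i h0.ge
            have h2 := hm i h0.le
            apply h
            simp only [PiLp.sub_apply, PiLp.smul_apply, smul_eq_mul]
            linarith
        have := Finset.card_lt_card this
        omega)
      (by
        intro i hi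
        have := hp i (hW i hi)
        simp only [PiLp.sub_apply, PiLp.smul_apply, smul_eq_mul]
        linarith)
    simp only [PiLp.sub_apply, PiLp.smul_apply, smul_eq_mul, Finset.sum_sub_distrib,
      ← Finset.mul_sum] at hup hum hun
    by_cases hv : ∀ i ∈ W, v i = 0
    · refine ⟨u + α • v, S.add_mem huS (S.smul_mem _ heS), ?_, ?_, ?_, ?_⟩
      · intro i hi
        simp [huW i hi, hv i hi]
      · intro i h
        have h1 := hp i h
        have h2 := hup i (by linarith)
        simp only [PiLp.add_apply, PiLp.smul_apply, smul_eq_mul]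
        constructor <;> linarith
      · intro i h
        have h1 := hm i h
        have h2 := hum i (by linarith)
        simp only [PiLp.add_apply, PiLp.smul_apply, smul_eq_mul]
        constructor <;> linarith
      · rw [Finset.sum_eq_zero hv, mul_zero, sub_zero] at hun
        rwa [show z - (u + α • v) = z - α • v - u by abel]
    · push Not at hv
      obtain ⟨j, hjW, hj⟩ := hv
      have hf : 0 < ∑ i ∈ W, v i :=
        Finset.sum_pos' hvW ⟨j, hjW, lt_of_le_of_ne (hvW j hjW) (Ne.symm hj)⟩
      refine ⟨u, huS, huW, ?_, ?_, ?_⟩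
      · intro i h
        have h1 := hp i h
        have h2 := hup i (by linarith)
        constructor <;> linarith
      · intro i h
        have h1 := hm i h
        have h2 := hum i (by linarith)
        constructor <;> linarith
      · rw [abs_of_pos hf, div_le_iff₀ hf] at hCe
        have h3 : ‖z - u‖ ≤ ‖z - α • v - u‖ + α * ‖v‖ := by
          have := norm_add_le (z - α • v - u) (α • v)
          rw [norm_smul, Real.norm_of_nonneg hα] at this
          rwa [show z - α • v - u + α • v = z - u by abel] at this
        have h4 := mul_le_mul_of_nonneg_left hCe hα
        linarith

/-- If `S` meets the open positive orthant and `S(c₀)` is a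
polyhedron of dimension at most two, then for any face `F_W` of `S(c₀)` (with `W`
maximal such that `F_W ⊆ Z_W`) there is `δ > 0` with
`dist(x, F_W) ≤ δ · dist(x, Z_W)` for all `x ∈ S(c₀)`. -/
theorem dist_face_le_dist_coordinate_subspace
    (n : ℕ) (S : Submodule ℝ (Vec n)) (c₀ : Vec n)
    (hSpos : ∃ v ∈ S, ∀ i : Fin n, 0 < v i)
    (hdim : Module.finrank ℝ (affineSpan ℝ (SClass S c₀)).direction ≤ 2)
    (W : Finset (Fin n))
    (hFne : (FFace S c₀ W).Nonempty)
    (hmax : ∀ i ∉ W, ∃ x ∈ FFace S c₀ W, x i ≠ 0) :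
    ∃ δ : ℝ, 0 < δ ∧
      ∀ x ∈ SClass S c₀,
        Metric.infDist x (FFace S c₀ W) ≤ δ * Metric.infDist x (ZSet n W) := by
  obtain ⟨C, hC0, hC⟩ := hoffman_aux S W
  refine ⟨C * W.card + 1, by positivity, ?_⟩
  rintro x ⟨hx0, hxS⟩
  obtain ⟨y, ⟨hy0, hyS⟩, hyZ⟩ := hFne
  have hyW : ∀ i ∈ W, y i = 0 := hyZ
  obtain ⟨u, huS, huW, hup, hum, hun⟩ := hC n (x - y)
    (by simpa using S.sub_mem hxS hyS)
    (by simpa using Finset.card_le_univ (Finset.univ.filter (fun i => (x - y) i ≠ 0)))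
    (by intro i hi; simpa [hyW i hi] using hx0 i)
  simp only [PiLp.sub_apply] at hup hum hun
  have hmem : y + u ∈ FFace S c₀ W := by
    refine ⟨⟨fun i => ?_, ?_⟩, ?_⟩
    · simp only [PiLp.add_apply]
      have h1 := hx0 i
      have h2 := hy0 i
      rcases le_total 0 (x i - y i) with h | h
      · have := hup i h
        linarith
      · have := hum i h
        linarith
    · rw [show y + u - c₀ = (y - c₀) + u by abel]
      exact S.add_mem hyS huS
    · intro i hi
      simp [hyW i hi, huW i hi]
  have hd : Metric.infDist x (FFace S c₀ W) ≤ C * ∑ i ∈ W, x i := by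
    refine (Metric.infDist_le_dist_of_mem hmem).trans ?_
    rw [dist_eq_norm, show x - (y + u) = x - y - u by abel]
    refine hun.trans_eq ?_
    congr 1
    exact Finset.sum_congr rfl fun i hi => by rw [hyW i hi, sub_zero]
  have hz : ∀ i ∈ W, x i ≤ Metric.infDist x (ZSet n W) := by
    intro i hi
    refine (Metric.le_infDist ⟨0, fun i _ => by simp⟩).mpr ?_
    intro w hw
    have h1 : w i = 0 := hw i hi
    have h2 := PiLp.norm_apply_le (x - w) i
    rw [← dist_eq_norm] at h2
    simp only [PiLp.sub_apply, h1, sub_zero] at h2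
    exact (le_abs_self _).trans h2
  have hs : ∑ i ∈ W, x i ≤ W.card * Metric.infDist x (ZSet n W) := by
    simpa using Finset.sum_le_card_nsmul W (fun i => x i) _ hz
  have h5 := mul_le_mul_of_nonneg_left hs hC0
  have h6 : 0 ≤ Metric.infDist x (ZSet n W) := Metric.infDist_nonneg
  linarith

end CRN
end
end

section
/- Let S ⊆ ℝⁿ be a linear subspace, let c₀ ∈ ℝⁿ, and let S(c₀) = (c₀+S) ∩ ℝⁿ_{≥0}. Then there exists λ > 0 with the following property: for every subset I ⊆ {1,…,n} and every point d = (d_1,…,d_n) ∈ S(c₀) with d_i < λ for all i ∈ I, one has S(c₀) ∩ Z_I ≠ ∅; equivalently, there is a nonempty face F_W of S(c₀) with I ⊆ W. -/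
open scoped BigOperators
noncomputable section
namespace CRN

variable {n : ℕ}

theorem exists_pos_le_all {ι : Type*} [Finite ι] (f : ι → ℝ) (hf : ∀ i, 0 < f i) :
    ∃ e : ℝ, 0 < e ∧ ∀ i, e ≤ f i := by
  have h1 : ∀ᶠ e in nhdsWithin (0 : ℝ) (Set.Ioi 0), ∀ i, e ≤ f i := by
    rw [Filter.eventually_all]
    intro i
    exact nhdsWithin_le_nhds ((eventually_lt_nhds (hf i)).mono fun _ h => h.le)
  have h2 : ∀ᶠ e in nhdsWithin (0 : ℝ) (Set.Ioi 0), 0 < e := self_mem_nhdsWithin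
  obtain ⟨e, he⟩ := (h2.and h1).exists
  exact ⟨e, he.1, he.2⟩

theorem compact_step {n : ℕ} (S : Submodule ℝ (Vec n)) (c₀ : Vec n) (I J : Finset (Fin n))
    (hinj : ∀ v ∈ S, (∀ i ∈ I, v i = 0) → (∀ i ∈ J, v i = 0) → v = 0)
    (h : ∀ e : ℝ, 0 < e → ∃ d ∈ SClass S c₀, (∀ i ∈ J, d i = 0) ∧ ∀ i ∈ I, d i < e) :
    (SClass S c₀ ∩ ZSet n I).Nonempty := by
  classical
  let L : S →ₗ[ℝ] (Fin n → ℝ) :=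
    { toFun := fun s i => if i ∈ I ∨ i ∈ J then (s : Vec n) i else 0
      map_add' := by
        intro a b; ext i; by_cases hi : i ∈ I ∨ i ∈ J <;> simp [hi]
      map_smul' := by
        intro a b; ext i; by_cases hi : i ∈ I ∨ i ∈ J <;> simp [hi] }
  have hL : ∀ (s : S) i, L s i = if i ∈ I ∨ i ∈ J then (s : Vec n) i else 0 := fun _ _ => rfl
  have hker : LinearMap.ker L = ⊥ := by
    rw [LinearMap.ker_eq_bot']
    intro s hs
    apply Subtype.ext
    refine hinj s s.2 ?_ ?_
    · intro i hi
      have := congrFun hs i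
      simpa [hL, hi] using this
    · intro i hi
      have := congrFun hs i
      simpa [hL, hi] using this
  have hemb := LinearMap.isClosedEmbedding_of_injective hker
  choose d hdP hdJ hdI using fun k : ℕ => h (1 / ((k : ℝ) + 1)) (by positivity)
  let s : ℕ → S := fun k => ⟨d k - c₀, (hdP k).2⟩
  have hlim : Filter.Tendsto (fun k => L (s k)) Filter.atTop
      (nhds (fun i => if i ∈ I ∨ i ∈ J then - c₀ i else 0)) := by
    rw [tendsto_pi_nhds]
    intro i
    by_cases hi : i ∈ I ∨ i ∈ J
    · simp only [hL, hi, if_true, s]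
      have h0 : Filter.Tendsto (fun k => d k i) Filter.atTop (nhds 0) := by
        refine squeeze_zero (fun k => (hdP k).1 i) (fun k => ?_)
          tendsto_one_div_add_atTop_nhds_zero_nat
        rcases hi with hi | hi
        · exact (hdI k i hi).le
        · rw [hdJ k i hi]; positivity
      simpa using h0.sub_const (c₀ i)
    · simp only [hL, hi, if_false]
      exact tendsto_const_nhds
  have hmem : (fun i => if i ∈ I ∨ i ∈ J then - c₀ i else 0) ∈ Set.range L :=
    hemb.isClosed_range.mem_of_tendsto hlim (Filter.Eventually.of_forall fun k => ⟨s k, rfl⟩)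
  obtain ⟨t, ht⟩ := hmem
  rw [← ht] at hlim
  have hst : Filter.Tendsto s Filter.atTop (nhds t) := hemb.isInducing.tendsto_nhds_iff.2 hlim
  have hst2 : Filter.Tendsto (fun k => (s k : Vec n)) Filter.atTop (nhds (t : Vec n)) :=
    (continuous_subtype_val.tendsto t).comp hst
  refine ⟨c₀ + t, ⟨fun i => ?_, by simp⟩, fun i hi => ?_⟩
  · have hc : Filter.Tendsto (fun k => (s k : Vec n) i) Filter.atTop (nhds ((t : Vec n) i)) :=
      ((EuclideanSpace.proj (𝕜 := ℝ) i).continuous.tendsto (t : Vec n)).comp hst2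
    have hc2 := hc.const_add (c₀ i)
    refine ge_of_tendsto' hc2 fun k => ?_
    have := (hdP k).1 i
    simpa [s] using this
  · have := congrFun ht i
    simp only [hL, hi, true_or, if_true] at this
    simp [this]

theorem move_step {n : ℕ} (S : Submodule ℝ (Vec n)) (c₀ v d : Vec n) (hv : v ∈ S)
    (hd : d ∈ SClass S c₀) (hneg : ∃ j, v j < 0) :
    ∃ j, v j < 0 ∧ ∃ x ∈ SClass S c₀, x j = 0 ∧ (∀ i, v i = 0 → x i = d i) := by
  classical
  obtain ⟨j0, hj0⟩ := hneg
  obtain ⟨j, hj, hmin⟩ := Finset.exists_min_image (Finset.univ.filter fun j => v j < 0)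
    (fun j => d j / (- v j)) ⟨j0, by simp [hj0]⟩
  have hjn : v j < 0 := by simpa using hj
  have ht : 0 ≤ d j / (- v j) := div_nonneg (hd.1 j) (by linarith)
  refine ⟨j, hjn, d + (d j / (- v j)) • v, ⟨fun i => ?_, ?_⟩, ?_, ?_⟩
  · simp only [PiLp.add_apply, PiLp.smul_apply, smul_eq_mul]
    rcases lt_or_ge (v i) 0 with hi | hi
    · have h1 := hmin i (by simp [hi])
      rw [le_div_iff₀ (by linarith)] at h1
      linarith
    · have := mul_nonneg ht hi
      have := hd.1 i
      linarith
  · have : d + (d j / (- v j)) • v - c₀ = (d - c₀) + (d j / (- v j)) • v := by abel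
    rw [this]
    exact S.add_mem hd.2 (S.smul_mem _ hv)
  · simp only [PiLp.add_apply, PiLp.smul_apply, smul_eq_mul]
    have := hjn.ne
    field_simp
    ring
  · intro i hi
    simp [hi]

theorem main_step {n : ℕ} (S : Submodule ℝ (Vec n)) (c₀ : Vec n) (I : Finset (Fin n)) :
    ∀ (m : ℕ) (J : Finset (Fin n)), Jᶜ.card = m →
    (∀ e : ℝ, 0 < e → ∃ d ∈ SClass S c₀, (∀ i ∈ J, d i = 0) ∧ ∀ i ∈ I, d i < e) →
    (SClass S c₀ ∩ ZSet n I).Nonempty := by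
  classical
  intro m
  induction m using Nat.strong_induction_on with
  | _ m ih =>
  intro J hJ h
  by_cases hinj : ∀ v ∈ S, (∀ i ∈ I, v i = 0) → (∀ i ∈ J, v i = 0) → v = 0
  · exact compact_step S c₀ I J hinj h
  have hex : ∃ v ∈ S, (∀ i ∈ I, v i = 0) ∧ (∀ i ∈ J, v i = 0) ∧ ∃ j, v j < 0 := by
    push Not at hinj
    obtain ⟨v, hv, hI, hJ, hne⟩ := hinj
    have : ∃ j, v j ≠ 0 := by
      by_contra hc
      push Not at hc
      exact hne (by ext i; simpa using hc i)
    obtain ⟨j, hj⟩ := this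
    rcases lt_or_gt_of_ne hj with hj | hj
    · exact ⟨v, hv, hI, hJ, j, hj⟩
    · exact ⟨-v, S.neg_mem hv, fun i hi => by simp [hI i hi], fun i hi => by simp [hJ i hi], j,
        by simpa using hj⟩
  obtain ⟨v, hv, hvI, hvJ, hneg⟩ := hex
  have key : ∃ j, v j < 0 ∧ ∀ e : ℝ, 0 < e → ∃ d ∈ SClass S c₀,
      (∀ i ∈ insert j J, d i = 0) ∧ ∀ i ∈ I, d i < e := by
    by_contra hc
    push Not at hc
    have hc2 : ∀ j, ∃ e : ℝ, 0 < e ∧ (v j < 0 → ∀ d ∈ SClass S c₀,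
        (∀ i ∈ insert j J, d i = 0) → ∃ i ∈ I, e ≤ d i) := by
      intro j
      by_cases hj : v j < 0
      · obtain ⟨e, he, h'⟩ := hc j hj
        exact ⟨e, he, fun _ => h'⟩
      · exact ⟨1, one_pos, fun h => absurd h hj⟩
    choose f hf hf2 using hc2
    obtain ⟨e, he, hef⟩ := exists_pos_le_all f hf
    obtain ⟨d, hd, hdJ, hdI⟩ := h e he
    obtain ⟨j, hj, x, hx, hxj, hxd⟩ := move_step S c₀ v d hv hd hneg
    obtain ⟨i, hi, hle⟩ := hf2 j hj x hx (by
      intro i hi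
      rcases Finset.mem_insert.1 hi with rfl | hi
      · exact hxj
      · rw [hxd i (hvJ i hi), hdJ i hi])
    rw [hxd i (hvI i hi)] at hle
    linarith [hdI i hi, hef j]
  obtain ⟨j, hj, hjj⟩ := key
  have hjJ : j ∉ J := fun hm => hj.ne (hvJ j hm)
  refine ih (insert j J)ᶜ.card ?_ (insert j J) rfl hjj
  rw [← hJ]
  refine Finset.card_lt_card (Finset.compl_ssubset_compl.2 (Finset.ssubset_insert hjJ))

/-- There is `λ > 0` such that whenever a point `d` of `S(c₀)`
has all its coordinates in `I` smaller than `λ`, the class `S(c₀)` meets `Z_I`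
(i.e. there is a nonempty face `F_W` with `I ⊆ W`). -/
theorem small_coordinates_near_face
    (n : ℕ) (S : Submodule ℝ (Vec n)) (c₀ : Vec n) :
    ∃ lam : ℝ, 0 < lam ∧
      ∀ (I : Finset (Fin n)) (d : Vec n), d ∈ SClass S c₀ →
        (∀ i ∈ I, d i < lam) → (SClass S c₀ ∩ ZSet n I).Nonempty := by
  have hI : ∀ I : Finset (Fin n), ∃ e : ℝ, 0 < e ∧ ∀ d ∈ SClass S c₀,
      (∀ i ∈ I, d i < e) → (SClass S c₀ ∩ ZSet n I).Nonempty := by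
    intro I
    by_contra hc
    push Not at hc
    have hne : (SClass S c₀ ∩ ZSet n I).Nonempty := by
      refine main_step S c₀ I _ ∅ rfl fun e he => ?_
      obtain ⟨d, hd, hdI, _⟩ := hc e he
      exact ⟨d, hd, by simp, hdI⟩
    obtain ⟨d, hd, hdI, hem⟩ := hc 1 one_pos
    exact hne.ne_empty hem
  choose f hf hf2 using hI
  obtain ⟨e, he, hef⟩ := exists_pos_le_all f hf
  exact ⟨e, he, fun I d hd h => hf2 I d hd fun i hi => (h i hi).trans_le (hef I)⟩

end CRN
end
end
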